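/- Let G be a finite group and let m = [G : Z(G)] be the index of the center. Then |C(G)| ≤ m · |C(Z(G))|, where C(H) denotes the set of cyclic subgroups of a group H. -/

import Mathlib

/-- On the divisors of a prime power, `1 / φ` is a nonnegative combination of the indicators
`n ↦ [n ∣ d]`, by telescoping over the exponent. -/
theorem Nat.exists_nonneg_inv_totient_eq_sum_prime_pow {p : ℕ} (hp : p.Prime) (a : ℕ) :
    ∃ c : ℕ → ℚ, (∀ d, 0 ≤ c d) ∧ ∀ n, n ∣ p ^ a →
      (n.totient : ℚ)⁻¹ = ∑ d ∈ (p ^ a).divisors, if n ∣ d then c d else 0 := by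
  set f : ℕ → ℚ := fun k => ((p ^ k).totient : ℚ)⁻¹ with hf
  have hanti : ∀ k, f (k + 1) ≤ f k := fun k => by
    have hpos : 0 < (p ^ k).totient := Nat.totient_pos.2 (pow_pos hp.pos k)
    have hle : (p ^ k).totient ≤ (p ^ (k + 1)).totient :=
      Nat.le_of_dvd (Nat.totient_pos.2 (pow_pos hp.pos _))
        (Nat.totient_dvd_of_dvd (pow_dvd_pow p k.le_succ))
    simp only [hf]
    gcongr
  have hnonneg : ∀ k, 0 ≤ f k := fun k => by positivity
  refine ⟨fun d => f (d.factorization p) - f (d.factorization p + 1) +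
    if d = p ^ a then f (a + 1) else 0, fun d => ?_, fun n hn => ?_⟩
  · have := hanti (d.factorization p)
    have := hnonneg (a + 1)
    dsimp only
    split_ifs <;> linarith
  · obtain ⟨j, hj, rfl⟩ := (Nat.dvd_prime_pow hp).1 hn
    rw [Nat.sum_divisors_prime_pow hp, ← Finset.sum_filter]
    have hfilter : (Finset.range (a + 1)).filter (fun k => p ^ j ∣ p ^ k) =
        Finset.Ico j (a + 1) := by
      ext k
      simp [Nat.pow_dvd_pow_iff_le_right hp.one_lt]
      tauto
    have htel : ∑ k ∈ Finset.Ico j (a + 1), (f k - f (k + 1)) = f j - f (a + 1) := by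
      have := Finset.sum_Ico_sub f (show j ≤ a + 1 by omega)
      rw [← neg_inj, ← Finset.sum_neg_distrib]
      simpa using this
    rw [hfilter]
    simp only [hp.factorization_pow, Finsupp.single_eq_same, Finset.sum_add_distrib, htel,
      Nat.pow_right_inj hp.one_lt]
    rw [Finset.sum_ite_eq', if_pos (by simp; omega)]
    ring

/-- On the divisors of `N`, the function `1 / φ` is a nonnegative combination of the indicators
`n ↦ [n ∣ d]` with `d ∣ N`. -/
theorem Nat.exists_nonneg_inv_totient_eq_sum {N : ℕ} (hN : N ≠ 0) :
    ∃ c : ℕ → ℚ, (∀ d, 0 ≤ c d) ∧ ∀ n, n ∣ N →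
      (n.totient : ℚ)⁻¹ = ∑ d ∈ N.divisors, if n ∣ d then c d else 0 := by
  induction N using Nat.recOnPrimeCoprime with
  | zero => exact absurd rfl hN
  | prime_pow p a hp => exact Nat.exists_nonneg_inv_totient_eq_sum_prime_pow hp a
  | coprime a b ha hb hab iha ihb =>
    obtain ⟨c₁, hc₁, h₁⟩ := iha (by omega)
    obtain ⟨c₂, hc₂, h₂⟩ := ihb (by omega)
    refine ⟨fun d => c₁ (d.gcd a) * c₂ (d.gcd b), fun d => mul_nonneg (hc₁ _) (hc₂ _),
      fun n hn => ?_⟩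
    obtain ⟨n₁, n₂, hn₁, hn₂, rfl⟩ := exists_dvd_and_dvd_of_dvd_mul hn
    have hdiv : (a * b).divisors = (a.divisors ×ˢ b.divisors).image fun p => p.1 * p.2 := by
      rw [Nat.divisors_mul]; rfl
    rw [Nat.totient_mul (hab.of_dvd hn₁ hn₂), Nat.cast_mul, mul_inv, h₁ n₁ hn₁, h₂ n₂ hn₂,
      hdiv, Finset.sum_image hab.mul_injOn_divisors, Finset.sum_mul_sum, Finset.sum_product]
    refine Finset.sum_congr rfl fun d₁ hd₁ => Finset.sum_congr rfl fun d₂ hd₂ => ?_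
    have hd₁ := Nat.dvd_of_mem_divisors hd₁
    have hd₂ := Nat.dvd_of_mem_divisors hd₂
    have hg₁ : (d₁ * d₂).gcd a = d₁ := by
      rw [Nat.Coprime.gcd_mul_right_cancel _ (hab.symm.coprime_dvd_left hd₂)]
      exact Nat.gcd_eq_left hd₁
    have hg₂ : (d₁ * d₂).gcd b = d₂ := by
      rw [Nat.Coprime.gcd_mul_left_cancel _ (hab.coprime_dvd_left hd₁)]
      exact Nat.gcd_eq_left hd₂
    have hiff : n₁ * n₂ ∣ d₁ * d₂ ↔ n₁ ∣ d₁ ∧ n₂ ∣ d₂ := by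
      refine ⟨fun h => ⟨?_, ?_⟩, fun h => mul_dvd_mul h.1 h.2⟩
      · exact (hab.of_dvd hn₁ hd₂).dvd_of_dvd_mul_right ((dvd_mul_right _ _).trans h)
      · exact (hab.symm.of_dvd hn₂ hd₁).dvd_of_dvd_mul_left ((dvd_mul_left _ _).trans h)
    simp only [hg₁, hg₂, hiff]
    split_ifs <;> simp_all

open Classical in
/-- A cyclic subgroup `H` has `φ |H|` generators. -/
theorem Subgroup.card_filter_zpowers_eq {G : Type*} [Group G] [Fintype G] (H : Subgroup G)
    [IsCyclic H] : (Finset.univ.filter fun x : G => zpowers x = H).card =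
      (Nat.card H).totient := by
  rw [← IsCyclic.card_orderOf_eq_totient (α := H) (d := Nat.card H)
    (by rw [Nat.card_eq_fintype_card]), ← Finset.card_map (Function.Embedding.subtype _)]
  congr 1
  ext x
  simp only [Finset.mem_filter, Finset.mem_univ, true_and, Finset.mem_map,
    Function.Embedding.subtype_apply]
  constructor
  · rintro rfl
    exact ⟨⟨x, mem_zpowers x⟩, by rw [orderOf_mk, Nat.card_zpowers], rfl⟩
  · rintro ⟨y, hy, rfl⟩
    refine eq_of_le_of_card_ge (zpowers_le.2 y.2) ?_
    rw [Nat.card_zpowers, orderOf_coe, hy]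

/-- The number of cyclic subgroups of a finite group is `∑ x, 1 / φ (orderOf x)`. -/
theorem Subgroup.card_isCyclic_eq_sum_inv_totient (G : Type*) [Group G] [Fintype G] :
    (Nat.card {H : Subgroup G // IsCyclic H} : ℚ) =
      ∑ x : G, ((orderOf x).totient : ℚ)⁻¹ := by
  classical
  have := Fintype.ofFinite {H : Subgroup G // IsCyclic H}
  let g : G → {H : Subgroup G // IsCyclic H} := fun x => ⟨zpowers x, inferInstance⟩
  rw [← Finset.sum_fiberwise Finset.univ g, Nat.card_eq_fintype_card, Fintype.card,
    Finset.card_eq_sum_ones, Nat.cast_sum]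
  refine Finset.sum_congr rfl fun H _ => ?_
  obtain ⟨H, hH⟩ := H
  have hfib : (Finset.univ.filter fun x : G => g x = ⟨H, hH⟩) =
      Finset.univ.filter fun x : G => zpowers x = H := by
    ext x; simp [g]
  rw [hfib, Finset.sum_congr rfl (g := fun _ => ((Nat.card H).totient : ℚ)⁻¹)]
  · rw [Finset.sum_const, card_filter_zpowers_eq, nsmul_eq_mul, mul_inv_cancel₀, Nat.cast_one]
    exact_mod_cast (Nat.totient_pos.2 Nat.card_pos).ne'
  · intro x hx
    rw [← Nat.card_zpowers, (Finset.mem_filter.1 hx).2]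

open Classical in
/-- A coset of the center has at most as many solutions of `x ^ d = 1` as the center itself. -/
theorem Subgroup.card_filter_mul_center_pow_eq_one_le {G : Type*} [Group G] [Fintype G] (g : G)
    (d : ℕ) : (Finset.univ.filter fun z : center G => (g * z) ^ d = 1).card ≤
      (Finset.univ.filter fun z : center G => z ^ d = 1).card := by
  rcases (Finset.univ.filter fun z : center G => (g * z) ^ d = 1).eq_empty_or_nonempty with h | h
  · simp [h]
  · obtain ⟨z₀, hz₀⟩ := h
    have hz₀ : (g * z₀) ^ d = 1 := (Finset.mem_filter.1 hz₀).2
    refine Finset.card_le_card_of_injOn (fun z => z₀⁻¹ * z) (fun z hz => ?_)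
      (mul_right_injective _).injOn
    have hz : (g * z) ^ d = 1 := by simpa using hz
    have hcomm : Commute (g * z₀) ((z₀⁻¹ * z : center G) : G) :=
      (mem_center_iff.1 (z₀⁻¹ * z).2 _)
    have hprod : g * z = g * z₀ * ((z₀⁻¹ * z : center G) : G) := by simp [mul_assoc]
    rw [hprod, hcomm.mul_pow, hz₀, one_mul] at hz
    simp only [Finset.coe_filter, Finset.mem_univ, true_and, Set.mem_ofPred_eq]
    exact_mod_cast hz

theorem Subgroup.sum_inv_totient_orderOf_mul_center_le {G : Type*} [Group G] [Fintype G]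
    [Fintype (center G)] (g : G) :
    ∑ z : center G, ((orderOf (g * z)).totient : ℚ)⁻¹ ≤
      ∑ z : center G, ((orderOf z).totient : ℚ)⁻¹ := by
  classical
  obtain ⟨c, hc, h⟩ := Nat.exists_nonneg_inv_totient_eq_sum (N := Nat.card G) Nat.card_pos.ne'
  have hL : ∀ z : center G, ((orderOf (g * z)).totient : ℚ)⁻¹ =
      ∑ d ∈ (Nat.card G).divisors, if (g * z) ^ d = 1 then c d else 0 := fun z => by
    simp only [h _ (_root_.orderOf_dvd_natCard (g * (z : G))), orderOf_dvd_iff_pow_eq_one]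
  have hR : ∀ z : center G, ((orderOf z).totient : ℚ)⁻¹ =
      ∑ d ∈ (Nat.card G).divisors, if z ^ d = 1 then c d else 0 := fun z => by
    simp only [h _ ((_root_.orderOf_dvd_natCard z).trans (card_subgroup_dvd_card _)),
      orderOf_dvd_iff_pow_eq_one]
  simp only [hL, hR]
  rw [Finset.sum_comm, Finset.sum_comm (s := Finset.univ)]
  refine Finset.sum_le_sum fun d _ => ?_
  rw [← Finset.sum_filter, ← Finset.sum_filter, Finset.sum_const, Finset.sum_const,
    nsmul_eq_mul, nsmul_eq_mul]
  refine mul_le_mul_of_nonneg_right ?_ (hc d)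
  have := card_filter_mul_center_pow_eq_one_le g d
  exact_mod_cast (by convert this)

/-- For a finite group `G` with `m = [G : Z(G)]`, one has `|C(G)| ≤ m · |C(Z(G))|`,
where `C(H)` denotes the set of cyclic subgroups of `H`. -/
theorem card_cyclic_subgroups_le (G : Type*) [Group G] [Finite G] :
    Nat.card {H : Subgroup G // IsCyclic H} ≤
      (Subgroup.center G).index *
        Nat.card {H : Subgroup (Subgroup.center G) // IsCyclic H} := by
  have := Fintype.ofFinite G
  have := Fintype.ofFinite (Subgroup.center G)
  rw [← Nat.cast_le (α := ℚ), Nat.cast_mul, Subgroup.card_isCyclic_eq_sum_inv_totient,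
    Subgroup.card_isCyclic_eq_sum_inv_totient]
  have hpos : (0 : ℚ) < Nat.card (Subgroup.center G) := by exact_mod_cast Nat.card_pos
  have hdouble : ∑ g : G, ∑ z : Subgroup.center G, ((orderOf (g * z)).totient : ℚ)⁻¹ =
      Nat.card (Subgroup.center G) * ∑ x : G, ((orderOf x).totient : ℚ)⁻¹ := by
    have hz (z : G) : ∑ g : G, ((orderOf (g * z)).totient : ℚ)⁻¹ =
        ∑ x : G, ((orderOf x).totient : ℚ)⁻¹ :=
      Equiv.sum_comp (Equiv.mulRight z) fun x => ((orderOf x).totient : ℚ)⁻¹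
    rw [Finset.sum_comm]
    simp [hz, Nat.card_eq_fintype_card]
  refine le_of_mul_le_mul_left ?_ hpos
  rw [← hdouble, ← mul_assoc, ← Nat.cast_mul, Subgroup.card_mul_index]
  refine (Finset.sum_le_sum fun g _ =>
    Subgroup.sum_inv_totient_orderOf_mul_center_le g).trans_eq ?_
  simp [Nat.card_eq_fintype_card]
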